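/- arXiv:2208.02583 — 3 statements merged into one kernel-verified Lean document; each statement's English description precedes it below -/
import Mathlib

section
/- Let l ≥ 1 be an integer and k a positive even integer; set α := ⌈l/2⌉ − 1 and β := ⌊l/2⌋ − 1. Define the l×l real matrix G (rows and columns indexed 0,...,l−1) by: G_{i,j} = 0 whenever i + j is odd; for even indices 2i, 2j ≤ l−1, G_{2i,2j} = (−1)^{α+j+k/2}·(2j)!·(k+i−1)!·(k+2i) / (4^{j}·i!·(α−i)!·(α+k+i)!) · ∑_{b=0}^{j} [∏_{d=0, d≠i}^{α} (b² − (k/2+d)²)] / [∏_{d=0, d≠b}^{j} (b² − d²)]; for odd indices 2i+1, 2j+1 ≤ l−1, G_{2i+1,2j+1} = (−1)^{β+j+k/2}·(2j+1)!·(k+i)! / (4^{β}·i!·(β−i)!·(β+k+i+1)!) · ∑_{b=0}^{j} [∏_{d=0, d≠i}^{β} ((2b+1)² − (k+2d+1)²)] / [∏_{d=0, d≠b}^{j} ((2b+1)² − (2d+1)²)]. Then G is the two-sided inverse of the matrix T_{k,l}, i.e. G·T_{k,l} = T_{k,l}·G = Id. -/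
open Finset Nat

/-- Newton's divided difference of the values `r` at the nodes `x 0, …, x n`. -/
noncomputable def dividedDifference {F : Type*} [Field F] (x r : ℕ → F) (n : ℕ) : F :=
  ∑ b ∈ range (n + 1), r b / ∏ d ∈ (range (n + 1)).erase b, (x b - x d)

section Newton

open Polynomial Lagrange

variable {F : Type*} [Field F]

/-- Newton's form of the interpolation polynomial. -/
theorem interpolate_eq_sum_dividedDifference (x r : ℕ → F) (n : ℕ)
    (hx : Set.InjOn x (range n)) :
    interpolate (range n) x r =
      ∑ j ∈ range n, C (dividedDifference x r j) * nodal (range j) x := by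
  induction n with
  | zero => simp
  | succ n ih =>
    have hx' : Set.InjOn x (range n) :=
      hx.mono (by exact_mod_cast range_subset_range.2 n.le_succ)
    have hdeg := degree_interpolate_lt (r := r) hx
    have hcoeff := coeff_eq_sum hx hdeg
    rw [card_range, Nat.add_sub_cancel] at hcoeff
    rw [sum_range_succ, ← ih hx', ← sub_eq_iff_eq_add]
    refine eq_interpolate_of_eval_eq r hx' ?_ fun i hi => ?_
    · rw [card_range] at hdeg ⊢
      rw [degree_lt_iff_coeff_zero] at hdeg ⊢
      intro m hm
      rcases hm.eq_or_lt with rfl | hm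
      · have hmon := nodal_monic (s := range n) (v := x)
        rw [Monic, leadingCoeff, natDegree_nodal, card_range] at hmon
        rw [coeff_sub, hcoeff, coeff_C_mul, hmon, mul_one, dividedDifference, sub_eq_zero]
        refine sum_congr rfl fun i hi => ?_
        rw [eval_interpolate_at_node r hx hi]
      · rw [coeff_sub, hdeg m hm, coeff_C_mul, coeff_eq_zero_of_natDegree_lt, mul_zero, sub_zero]
        rwa [natDegree_nodal, card_range]
    · rw [eval_sub, eval_interpolate_at_node r hx
        (mem_range.2 ((mem_range.1 hi).trans n.lt_succ_self)),
        eval_mul, eval_nodal_at_node hi, mul_zero, sub_zero]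

theorem eval_eq_sum_dividedDifference (x : ℕ → F) (n : ℕ) (hx : Set.InjOn x (range n))
    (P : F[X]) (hP : P.degree < n) (y : F) :
    P.eval y = ∑ j ∈ range n,
      dividedDifference x (fun b => P.eval (x b)) j * ∏ e ∈ range j, (y - x e) := by
  have h := eq_interpolate (f := P) hx (by rwa [card_range])
  rw [interpolate_eq_sum_dividedDifference x _ n hx] at h
  simpa only [eval_finsetSum, eval_mul, eval_C, eval_nodal] using congr_arg (eval y) h

/-- Newton's form of the unnormalised Lagrange basis polynomials for the nodes `y`,
evaluated at those nodes. -/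
theorem sum_dividedDifference_prod_erase (x y : ℕ → F) (n : ℕ)
    (hx : Set.InjOn x (range (n + 1))) {i m : ℕ} (hi : i ≤ n) (hm : m ≤ n) :
    ∑ j ∈ range (n + 1),
      dividedDifference x (fun b => ∏ d ∈ (range (n + 1)).erase i, (x b - y d)) j *
        ∏ e ∈ range j, (y m - x e) =
      if i = m then ∏ d ∈ (range (n + 1)).erase i, (y i - y d) else 0 := by
  have h := eval_eq_sum_dividedDifference x (n + 1) hx (nodal ((range (n + 1)).erase i) y)
    (by
      rw [degree_nodal, card_erase_of_mem (by simpa using hi), card_range]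
      exact_mod_cast n.lt_succ_self) (y m)
  simp only [eval_nodal] at h
  rw [← h]
  split_ifs with him
  · rw [him]
  · exact prod_eq_zero (mem_erase.2 ⟨Ne.symm him, by simpa using hm⟩) (sub_self _)

end Newton

section ChebyshevCoeff

open Polynomial

theorem factorial_mul_coeff_eq_eval_iterate_derivative (p : ℝ[X]) (m : ℕ) :
    (m ! : ℝ) * p.coeff m = (derivative^[m] p).eval 0 := by
  rw [← coeff_zero_eq_eval_zero, coeff_iterate_derivative, zero_add, Nat.descFactorial_self,
    nsmul_eq_mul]

theorem factorial_mul_coeff_T_even (n m : ℕ) :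
    ((2 * m)! : ℝ) * (Chebyshev.T ℝ (2 * n : ℤ)).coeff (2 * m) =
      (-1) ^ (n + m) * 4 ^ m * ∏ e ∈ range m, ((n : ℝ) ^ 2 - (e : ℝ) ^ 2) := by
  rw [factorial_mul_coeff_eq_eval_iterate_derivative]
  induction m with
  | zero => simp
  | succ m ih =>
    rw [mul_add, mul_one, Chebyshev.iterate_derivative_T_eval_zero_recurrence, ih, prod_range_succ]
    push_cast
    ring

theorem factorial_mul_coeff_T_odd (n m : ℕ) :
    ((2 * m + 1)! : ℝ) * (Chebyshev.T ℝ (2 * n + 1 : ℤ)).coeff (2 * m + 1) =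
      (-1) ^ (n + m) * (2 * n + 1) *
        ∏ e ∈ range m, ((2 * (n : ℝ) + 1) ^ 2 - (2 * (e : ℝ) + 1) ^ 2) := by
  rw [factorial_mul_coeff_eq_eval_iterate_derivative]
  induction m with
  | zero =>
    simp [Chebyshev.T_derivative_eq_U]
    ring
  | succ m ih =>
    rw [show 2 * (m + 1) + 1 = 2 * m + 1 + 2 by ring,
      Chebyshev.iterate_derivative_T_eval_zero_recurrence, ih, prod_range_succ]
    push_cast
    ring

theorem coeff_T_eq_zero_of_odd_add (n m : ℕ) (h : Odd (n + m)) :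
    (Chebyshev.T ℝ (n : ℤ)).coeff m = 0 := by
  suffices hz : (derivative^[m] (Chebyshev.T ℝ (n : ℤ))).eval 0 = 0 by
    rw [← factorial_mul_coeff_eq_eval_iterate_derivative] at hz
    exact (mul_eq_zero.1 hz).resolve_left (by positivity)
  induction m using Nat.twoStepInduction with
  | zero => exact Chebyshev.T_eval_zero_of_odd ℝ (by exact_mod_cast h)
  | one =>
    have hn : Odd ((n : ℤ) - 1) := by
      rcases h with ⟨t, ht⟩
      exact ⟨t - 1, by lia⟩
    simp [Chebyshev.T_derivative_eq_U, hn]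
  | more m ih _ =>
    rw [Chebyshev.iterate_derivative_T_eval_zero_recurrence, ih (by grind), mul_zero]

end ChebyshevCoeff

theorem prod_erase_sub (i t : ℕ) :
    ∏ d ∈ (range (i + t + 1)).erase i, ((i : ℝ) - d) = (-1) ^ t * (i ! : ℝ) * (t ! : ℝ) := by
  induction t with
  | zero =>
    rw [add_zero, range_add_one, erase_insert notMem_range_self]
    induction i with
    | zero => simp
    | succ i ih =>
      rw [prod_range_succ', Nat.factorial_succ]
      simp only [Nat.cast_add, Nat.cast_one, add_sub_add_right_eq_sub, ih]
      simp
      ring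
  | succ t ih =>
    rw [← add_assoc, range_add_one, erase_insert_of_ne (by lia), prod_insert (by simp), ih,
      Nat.factorial_succ]
    push_cast
    ring

theorem prod_range_add_mul_factorial (K n : ℕ) (hK : 0 < K) :
    (∏ d ∈ range n, ((K : ℝ) + d)) * ((K - 1)! : ℝ) = ((K + n - 1)! : ℝ) := by
  induction n with
  | zero => simp
  | succ n ih =>
    rw [prod_range_succ, mul_right_comm, ih, show K + (n + 1) - 1 = K + n - 1 + 1 by lia,
      Nat.factorial_succ, show K + n - 1 + 1 = K + n by lia]
    push_cast
    ring

theorem prod_erase_sub_mul_add (n K i : ℕ) (hK : 0 < K) (hi : i ≤ n) :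
    (∏ d ∈ (range (n + 1)).erase i, (((i : ℝ) - d) * (K + i + d))) *
      (((K + i - 1)! : ℝ) * (K + 2 * i)) =
      (-1) ^ (n + i) * (i ! : ℝ) * ((n - i)! : ℝ) * ((n + K + i)! : ℝ) := by
  obtain ⟨t, rfl⟩ := Nat.exists_eq_add_of_le hi
  have h := prod_range_add_mul_factorial (K + i) (i + t + 1) (by lia)
  rw [← mul_prod_erase (range (i + t + 1)) _ (show i ∈ range (i + t + 1) by simp),
    show K + i + (i + t + 1) - 1 = i + t + K + i by lia] at h
  rw [prod_mul_distrib, prod_erase_sub, ← h, Nat.add_sub_cancel_left,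
    show i + t + i = t + 2 * i by ring, pow_add, pow_mul]
  push_cast
  ring

theorem Fin.sum_univ_eq_sum_range_of_parity {l n ε : ℕ} (f : Fin l → ℝ) (g : ℕ → ℝ) (hε : ε < 2)
    (hn : ∀ j, j < n ↔ 2 * j + ε < l)
    (hfg : ∀ (j : ℕ) (hj : 2 * j + ε < l), f ⟨2 * j + ε, hj⟩ = g j)
    (hf : ∀ s : Fin l, s.val % 2 ≠ ε → f s = 0) :
    ∑ s, f s = ∑ j ∈ range n, g j := by
  have hs : ∀ s : Fin l, f s = if s.val % 2 = ε then g (s.val / 2) else 0 := fun s => by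
    split_ifs with h
    · rw [← hfg (s.val / 2) (by lia)]
      congr 1
      ext
      simp only
      lia
    · exact hf s h
  rw [sum_congr rfl fun s _ => hs s,
    Fin.sum_univ_eq_sum_range (fun s => if s % 2 = ε then g (s / 2) else 0) l]
  refine (sum_of_injOn (fun j => 2 * j + ε) (fun a _ b _ h => by simpa using h)
    (fun j hj => ?_) (fun s hs hs' => ?_) (fun j _ => ?_)).symm
  · simp only [coe_range, Set.mem_Iio] at hj ⊢
    exact (hn j).1 hj
  · refine if_neg fun h => hs' ⟨s / 2, ?_, by simp only; lia⟩
    simp only [coe_range, Set.mem_Iio, mem_range] at hs ⊢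
    exact (hn _).2 (by lia)
  · rw [if_pos (by lia), show (2 * j + ε) / 2 = j by lia]

theorem sum_even_inverse_entry_mul_coeff_T (κ α i m : ℕ) (hκ : 0 < κ) (hi : i ≤ α) (hm : m ≤ α) :
    ∑ j ∈ range (α + 1),
      ((-1 : ℝ) ^ (α + j + κ) * ((2 * j)! : ℝ) * ((2 * κ + i - 1)! : ℝ) * ((2 * κ : ℕ) + 2 * i) /
          ((4 : ℝ) ^ j * (i ! : ℝ) * ((α - i)! : ℝ) * ((α + 2 * κ + i)! : ℝ)) *
        dividedDifference (fun b => (b : ℝ) ^ 2)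
          (fun b => ∏ d ∈ (range (α + 1)).erase i, ((b : ℝ) ^ 2 - ((κ : ℝ) + d) ^ 2)) j) *
        (Polynomial.Chebyshev.T ℝ (2 * (κ + m : ℕ) : ℤ)).coeff (2 * j) =
      if i = m then 1 else 0 := by
  have hinj : Set.InjOn (fun b : ℕ => (b : ℝ) ^ 2) (range (α + 1)) := fun a _ b _ h => by
    simpa using h
  have key := sum_dividedDifference_prod_erase (fun b : ℕ => (b : ℝ) ^ 2)
    (fun d : ℕ => ((κ : ℝ) + d) ^ 2) α hinj hi hm
  trans (-1 : ℝ) ^ (α + m) * (((2 * κ + i - 1)! : ℝ) * ((2 * κ : ℕ) + 2 * i)) /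
      ((i ! : ℝ) * ((α - i)! : ℝ) * ((α + 2 * κ + i)! : ℝ)) *
    (if i = m then ∏ d ∈ (range (α + 1)).erase i,
        (((κ : ℝ) + i) ^ 2 - ((κ : ℝ) + d) ^ 2) else 0)
  · rw [← key, mul_sum]
    refine sum_congr rfl fun j _ => ?_
    have hc := factorial_mul_coeff_T_even (κ + m) j
    have hc' : (Polynomial.Chebyshev.T ℝ (2 * (κ + m : ℕ) : ℤ)).coeff (2 * j) =
        (-1) ^ (κ + m + j) * 4 ^ j * (∏ e ∈ range j, (((κ + m : ℕ) : ℝ) ^ 2 - (e : ℝ) ^ 2)) /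
          ((2 * j)! : ℝ) := by
      rw [eq_div_iff (by positivity), ← hc, mul_comm]
    have hsign : (-1 : ℝ) ^ (α + j + κ) * (-1) ^ (κ + m + j) = (-1) ^ (α + m) := by
      rw [← pow_add, show α + j + κ + (κ + m + j) = α + m + 2 * (j + κ) by ring, pow_add, pow_mul]
      simp
    rw [hc', ← hsign]
    push_cast
    field_simp
  split_ifs with him
  · subst him
    have hd := prod_erase_sub_mul_add α (2 * κ) i (by lia) hi
    have hp : ∏ d ∈ (range (α + 1)).erase i, (((κ : ℝ) + i) ^ 2 - ((κ : ℝ) + d) ^ 2) =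
        ∏ d ∈ (range (α + 1)).erase i, (((i : ℝ) - d) * ((2 * κ : ℕ) + i + d)) :=
      prod_congr rfl fun d _ => by push_cast; ring
    rw [hp, div_mul_eq_mul_div, div_eq_one_iff_eq (by positivity), mul_assoc,
      mul_comm _ (∏ _ ∈ _, _), hd]
    simp only [← mul_assoc]
    rw [← pow_add, (Even.add_self (α + i)).neg_one_pow, one_mul]
  · rw [mul_zero]

theorem sum_odd_inverse_entry_mul_coeff_T (κ β i m : ℕ) (hi : i ≤ β) (hm : m ≤ β) :
    ∑ j ∈ range (β + 1),
      ((-1 : ℝ) ^ (β + j + κ) * ((2 * j + 1)! : ℝ) * ((2 * κ + i)! : ℝ) /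
          ((4 : ℝ) ^ β * (i ! : ℝ) * ((β - i)! : ℝ) * ((β + 2 * κ + i + 1)! : ℝ)) *
        dividedDifference (fun b => (2 * (b : ℝ) + 1) ^ 2)
          (fun b => ∏ d ∈ (range (β + 1)).erase i,
            ((2 * (b : ℝ) + 1) ^ 2 - (((2 * κ : ℕ) : ℝ) + 2 * d + 1) ^ 2)) j) *
        (Polynomial.Chebyshev.T ℝ (2 * (κ + m : ℕ) + 1 : ℤ)).coeff (2 * j + 1) =
      if i = m then 1 else 0 := by
  have hinj : Set.InjOn (fun b : ℕ => (2 * (b : ℝ) + 1) ^ 2) (range (β + 1)) := fun a _ b _ h => by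
    have h' := (pow_left_inj₀ (by positivity) (by positivity) two_ne_zero).1 h
    simpa using h'
  have key := sum_dividedDifference_prod_erase (fun b : ℕ => (2 * (b : ℝ) + 1) ^ 2)
    (fun d : ℕ => (((2 * κ : ℕ) : ℝ) + 2 * d + 1) ^ 2) β hinj hi hm
  trans (-1 : ℝ) ^ (β + m) * (((2 * κ + i)! : ℝ) * (2 * (κ + m : ℕ) + 1)) /
      ((4 : ℝ) ^ β * (i ! : ℝ) * ((β - i)! : ℝ) * ((β + 2 * κ + i + 1)! : ℝ)) *
    (if i = m then ∏ d ∈ (range (β + 1)).erase i,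
        ((((2 * κ : ℕ) : ℝ) + 2 * i + 1) ^ 2 - (((2 * κ : ℕ) : ℝ) + 2 * d + 1) ^ 2) else 0)
  · rw [← key, mul_sum]
    refine sum_congr rfl fun j _ => ?_
    have hc := factorial_mul_coeff_T_odd (κ + m) j
    have hc' : (Polynomial.Chebyshev.T ℝ (2 * (κ + m : ℕ) + 1 : ℤ)).coeff (2 * j + 1) =
        (-1) ^ (κ + m + j) * (2 * (κ + m : ℕ) + 1) *
          (∏ e ∈ range j, ((((2 * κ : ℕ) : ℝ) + 2 * m + 1) ^ 2 - (2 * (e : ℝ) + 1) ^ 2)) /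
          ((2 * j + 1)! : ℝ) := by
      rw [eq_div_iff (by positivity), mul_comm, hc]
      push_cast
      simp only [mul_add]
    have hsign : (-1 : ℝ) ^ (β + j + κ) * (-1) ^ (κ + m + j) = (-1) ^ (β + m) := by
      rw [← pow_add, show β + j + κ + (κ + m + j) = β + m + 2 * (j + κ) by ring, pow_add, pow_mul]
      simp
    rw [hc', ← hsign]
    field_simp
  split_ifs with him
  · subst him
    have hd := prod_erase_sub_mul_add β (2 * κ + 1) i (by lia) hi
    rw [show 2 * κ + 1 + i - 1 = 2 * κ + i by lia,
      show β + (2 * κ + 1) + i = β + 2 * κ + i + 1 by ring] at hd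
    have hp : ∏ d ∈ (range (β + 1)).erase i,
        ((((2 * κ : ℕ) : ℝ) + 2 * i + 1) ^ 2 - (((2 * κ : ℕ) : ℝ) + 2 * d + 1) ^ 2) =
        4 ^ β * ∏ d ∈ (range (β + 1)).erase i, (((i : ℝ) - d) * ((2 * κ + 1 : ℕ) + i + d)) := by
      rw [show (4 : ℝ) ^ β = ∏ d ∈ (range (β + 1)).erase i, 4 by
        rw [prod_const, card_erase_of_mem (by simpa using hi), card_range, Nat.add_sub_cancel],
        ← prod_mul_distrib]
      exact prod_congr rfl fun d _ => by push_cast; ring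
    have hN : (2 * (κ + i : ℕ) + 1 : ℝ) = (2 * κ + 1 : ℕ) + 2 * i := by
      push_cast
      ring
    rw [hp, hN, div_mul_eq_mul_div, div_eq_one_iff_eq (by positivity), mul_assoc,
      mul_left_comm _ (4 ^ β), mul_comm _ (∏ _ ∈ _, _), hd, mul_left_comm]
    simp only [← mul_assoc]
    rw [mul_assoc (4 ^ β), ← pow_add, (Even.add_self (β + i)).neg_one_pow, mul_one]
  · rw [mul_zero]

theorem stmt_1 (l k : ℕ) (hl : 1 ≤ l) (hk : 0 < k) (hke : Even k)
    (α β : ℕ) (hα : α = (l + 1) / 2 - 1) (hβ : β = l / 2 - 1)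
    (G : Matrix (Fin l) (Fin l) ℝ)
    (hG0 : ∀ i j : Fin l, (i.val + j.val) % 2 = 1 → G i j = 0)
    (hGeven : ∀ (i j : ℕ) (hi : 2 * i < l) (hj : 2 * j < l),
      G ⟨2 * i, hi⟩ ⟨2 * j, hj⟩ =
        (-1 : ℝ) ^ (α + j + k / 2) * ((2 * j)! : ℝ) * ((k + i - 1)! : ℝ) * (k + 2 * i) /
          ((4 : ℝ) ^ j * ((i)! : ℝ) * ((α - i)! : ℝ) * ((α + k + i)! : ℝ)) *
        ∑ b ∈ Finset.range (j + 1),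
          (∏ d ∈ (Finset.range (α + 1)).erase i,
              ((b : ℝ) ^ 2 - ((k / 2 : ℕ) + (d : ℝ)) ^ 2)) /
            ∏ d ∈ (Finset.range (j + 1)).erase b, ((b : ℝ) ^ 2 - (d : ℝ) ^ 2))
    (hGodd : ∀ (i j : ℕ) (hi : 2 * i + 1 < l) (hj : 2 * j + 1 < l),
      G ⟨2 * i + 1, hi⟩ ⟨2 * j + 1, hj⟩ =
        (-1 : ℝ) ^ (β + j + k / 2) * ((2 * j + 1)! : ℝ) * ((k + i)! : ℝ) /
          ((4 : ℝ) ^ β * ((i)! : ℝ) * ((β - i)! : ℝ) * ((β + k + i + 1)! : ℝ)) *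
        ∑ b ∈ Finset.range (j + 1),
          (∏ d ∈ (Finset.range (β + 1)).erase i,
              ((2 * (b : ℝ) + 1) ^ 2 - ((k : ℝ) + 2 * d + 1) ^ 2)) /
            ∏ d ∈ (Finset.range (j + 1)).erase b,
              ((2 * (b : ℝ) + 1) ^ 2 - (2 * (d : ℝ) + 1) ^ 2))
    (T : Matrix (Fin l) (Fin l) ℝ)
    (hT : ∀ i j : Fin l,
      T i j = (Polynomial.Chebyshev.T ℝ ((k : ℤ) + (j : ℤ))).coeff i) :
    G * T = 1 ∧ T * G = 1 := by
  obtain ⟨κ, rfl⟩ := hke.two_dvd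
  have hκ : 0 < κ := by lia
  rw [Nat.mul_div_cancel_left κ two_pos] at hGeven hGodd
  have hT0 : ∀ i j : Fin l, (i.val + j.val) % 2 = 1 → T i j = 0 := fun i j h => by
    rw [hT, ← Nat.cast_add]
    exact coeff_T_eq_zero_of_odd_add _ _ (Nat.odd_iff.2 (by lia))
  suffices hGT : G * T = 1 from ⟨hGT, mul_eq_one_comm.1 hGT⟩
  ext r c
  rw [Matrix.mul_apply, Matrix.one_apply]
  by_cases hrc : (r.val + c.val) % 2 = 1
  · rw [if_neg (by rintro rfl; lia)]
    refine sum_eq_zero fun s _ => ?_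
    by_cases hs : (r.val + s.val) % 2 = 1
    · rw [hG0 r s hs, zero_mul]
    · rw [hT0 s c (by lia), mul_zero]
  obtain ⟨r, hr⟩ := r
  obtain ⟨c, hc⟩ := c
  simp only at hrc
  rcases Nat.even_or_odd' r with ⟨i, rfl | rfl⟩
  · obtain ⟨m, rfl⟩ : 2 ∣ c := by lia
    have hblock := sum_even_inverse_entry_mul_coeff_T κ α i m hκ (by lia) (by lia)
    simp only [Fin.mk.injEq, mul_right_inj' (two_ne_zero' ℕ)]
    rw [← hblock]
    refine Fin.sum_univ_eq_sum_range_of_parity (ε := 0) _ _ two_pos (by lia) (fun j hj => ?_)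
      fun s hs => ?_
    · simp only [add_zero] at hj ⊢
      rw [hGeven i j hr hj, hT]
      congr 3
      push_cast
      ring
    · rw [hG0 _ s (by simp only; lia), zero_mul]
  · obtain ⟨m, rfl⟩ : ∃ m, c = 2 * m + 1 := ⟨c / 2, by lia⟩
    have hblock := sum_odd_inverse_entry_mul_coeff_T κ β i m (by lia) (by lia)
    simp only [Fin.mk.injEq, add_left_inj, mul_right_inj' (two_ne_zero' ℕ)]
    rw [← hblock]
    refine Fin.sum_univ_eq_sum_range_of_parity (ε := 1) _ _ one_lt_two (by lia) (fun j hj => ?_)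
      fun s hs => ?_
    · rw [hGodd i j hr hj, hT]
      congr 3
      push_cast
      ring
    · rw [hG0 _ s (by simp only; lia), zero_mul]
end

section
/- Let t, k, r be natural numbers with t ≥ 2, t ≤ k ≤ r − 1, and r ≥ 2·L^t·t^{3/2} (an inequality between the natural number r and a real number). Then |A(t,k,r)| < 3 · C(r−1, t). -/
open Finset Real

/-- `A(t,k,r) = ∑_{j=0}^{min(k,t)} (−1)^j C(k,j) C(j+t,j) C(r−j−1, r−t−1)`. -/
def A (t k r : ℕ) : ℤ :=
  ∑ j ∈ Finset.range (min k t + 1),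
    (-1 : ℤ) ^ j * (Nat.choose k j : ℤ) * (Nat.choose (j + t) j : ℤ) *
      (Nat.choose (r - j - 1) (r - t - 1) : ℤ)

/-- The constant `L = (√2+1)^{1+1/√2} · (√2−1)^{−1+1/√2} · 2^{−1/(2√2)} = 4.56...` -/
noncomputable def Lconst : ℝ :=
  (Real.sqrt 2 + 1) ^ ((1 : ℝ) + 1 / Real.sqrt 2) *
    (Real.sqrt 2 - 1) ^ ((-1 : ℝ) + 1 / Real.sqrt 2) *
    (2 : ℝ) ^ (-(1 / (2 * Real.sqrt 2)))

/-- The Sonin-type energy of a solution of the discrete Legendre equation stays bounded on the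
first half of `{0, …, N}`, hence so does the solution. -/
lemma sq_le_of_discrete_legendre {N : ℕ} {c : ℝ} (hc : 0 < c) (hcN : c ≤ N) {y : ℕ → ℝ}
    (h0 : N * (y 1 - y 0) = -c * y 0)
    (hy : ∀ x : ℕ, x + 1 < N → (x + 2 : ℝ) * (N - x - 1) * (y (x + 2) - y (x + 1))
      - (x + 1) * (N - x) * (y (x + 1) - y x) = -c * y (x + 1))
    {x : ℕ} (hx : 2 * x ≤ N) : y x ^ 2 ≤ 2 * y 0 ^ 2 := by
  have hN : (0 : ℝ) < N := hc.trans_le hcN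
  have hN1 : 1 ≤ N := by exact_mod_cast hN
  have weight_ge (x : ℕ) (hx : 2 * x ≤ N) : (N : ℝ) ≤ (x + 1) * (N - x) := by
    have h1 : (x : ℝ) + 1 ≤ N := by
      have : x + 1 ≤ N := by omega
      exact_mod_cast this
    nlinarith [mul_nonneg (Nat.cast_nonneg (α := ℝ) x) (sub_nonneg.2 h1)]
  have sq_le {p a b : ℝ} (hp : (N : ℝ) ≤ p)
      (h : c * (a * b) + p * (a - b) ^ 2 ≤
        c * y 0 ^ 2 * (1 + c / 2 * (1 / N - 1 / p))) : a ^ 2 ≤ 2 * y 0 ^ 2 := by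
    have hp0 : 0 < p := hN.trans_le hp
    have h1 : c / 2 * (1 / N - 1 / p) ≤ 1 / 2 := by
      have h2 : c / N ≤ 1 := (div_le_one hN).2 hcN
      have h3 : 0 ≤ c / p := by positivity
      calc c / 2 * (1 / N - 1 / p) = (c / N - c / p) / 2 := by ring
        _ ≤ 1 / 2 := by linarith
    have h2 : c * y 0 ^ 2 * (1 + c / 2 * (1 / N - 1 / p)) ≤ c * y 0 ^ 2 * (3 / 2) :=
      mul_le_mul_of_nonneg_left (by linarith) (by positivity)
    have h3 : c * (a - b) ^ 2 ≤ p * (a - b) ^ 2 :=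
      mul_le_mul_of_nonneg_right (hcN.trans hp) (sq_nonneg _)
    have h4 : c * (a * b + (a - b) ^ 2) ≤ c * (y 0 ^ 2 * (3 / 2)) := by linarith
    have h5 := le_of_mul_le_mul_left h4 hc
    nlinarith [sq_nonneg (a - 2 * b)]
  have energy (x : ℕ) (hx : 2 * x ≤ N) :
      c * (y (x + 1) * y x) + (x + 1) * (N - x) * (y (x + 1) - y x) ^ 2 ≤
        c * y 0 ^ 2 * (1 + c / 2 * (1 / N - 1 / ((x + 1) * (N - x)))) := by
    induction x with
    | zero =>
      have h1 : c * (y 1 * y 0) + N * (y 1 - y 0) ^ 2 = c * y 0 ^ 2 := by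
        linear_combination (y 1 - y 0) * h0
      simp [h1]
    | succ x ih =>
      have ih := ih (by omega)
      have hp := weight_ge x (by omega)
      have hq := weight_ge (x + 1) hx
      have hy' := hy x (by omega)
      have hb := sq_le hp ih
      have hpq : ((x : ℝ) + 1) * (N - x) ≤ (x + 2) * (N - x - 1) := by
        have : ((2 * (x + 1) : ℕ) : ℝ) ≤ N := by exact_mod_cast hx
        push_cast at this
        linarith
      push_cast at hq ⊢
      rw [show (x : ℝ) + 1 + 1 = x + 2 by ring,
        show (N : ℝ) - (x + 1) = N - x - 1 by ring] at hq ⊢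
      rw [show x + 1 + 1 = x + 2 by ring]
      generalize ((x : ℝ) + 1) * (N - x) = p at *
      generalize ((x : ℝ) + 2) * (N - x - 1) = q at *
      generalize y (x + 2) = a at *
      generalize y (x + 1) = b at *
      generalize y x = d at *
      have hp0 : 0 < p := hN.trans_le hp
      have hq0 : 0 < q := hN.trans_le hq
      have h1 : -((b - d) * (a - b)) * (p * q) ≤ c ^ 2 * y 0 ^ 2 / 2 := by
        have h2 : -((b - d) * (a - b)) * (p * q) =
            c ^ 2 * b ^ 2 / 4 - (p * (b - d) - c * b / 2) ^ 2 := by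
          linear_combination -(p * (b - d)) * hy'
        nlinarith [sq_nonneg (p * (b - d) - c * b / 2), mul_le_mul_of_nonneg_left hb (sq_nonneg c)]
      have h2 : -((b - d) * (a - b)) ≤ c ^ 2 * y 0 ^ 2 / 2 / (p * q) :=
        (le_div_iff₀ (by positivity)).2 h1
      have h3 := mul_le_mul_of_nonneg_left h2 (sub_nonneg.2 hpq)
      have h4 : (q - p) * (c ^ 2 * y 0 ^ 2 / 2 / (p * q)) =
          c * y 0 ^ 2 * (c / 2 * (1 / p - 1 / q)) := by
        field_simp
      have h5 : c * (a * b) + q * (a - b) ^ 2 - (c * (b * d) + p * (b - d) ^ 2) =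
          (q - p) * -((b - d) * (a - b)) := by
        linear_combination (a - d) * hy'
      linarith
  cases x with
  | zero => nlinarith [sq_nonneg (y 0)]
  | succ x => exact sq_le (weight_ge x (by omega)) (energy x (by omega))

/-- The solution of the discrete Legendre equation on `{0, …, N}`, in the binomial basis. -/
noncomputable def discreteLegendre (N t x : ℕ) : ℝ :=
  ∑ j ∈ range (t + 1), (-1) ^ j * (j + t).choose j * (N - j).choose (N - t) * x.choose j

lemma discreteLegendre_zero (N t : ℕ) (h : t ≤ N) : discreteLegendre N t 0 = N.choose t := by
  rw [discreteLegendre, sum_range_succ']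
  simp [Nat.choose_symm h]

lemma discreteLegendre_self (N t : ℕ) (h : t ≤ N) :
    discreteLegendre N t N = (-1) ^ t * N.choose t := by
  have h1 : ∑ j ∈ range (t + 1), (-1 : ℝ) ^ j * t.choose j * (t + j).choose t = (-1) ^ t := by
    have h2 := Polynomial.shiftedLegendre_eval_symm t (1 : ℝ)
    simpa [Polynomial.shiftedLegendre, Polynomial.aeval_def, Polynomial.eval₂_finsetSum,
      sum_range_succ'] using h2
  rw [← h1, sum_mul]
  refine sum_congr rfl fun j hj => ?_
  have hj : j ≤ t := by simpa [Nat.lt_succ_iff] using hj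
  have h3 : ((N.choose t * t.choose j : ℕ) : ℝ) = (N.choose j * (N - j).choose (t - j) : ℕ) :=
    congrArg _ (Nat.choose_mul hj)
  push_cast at h3
  have h4 : (N - j).choose (N - t) = (N - j).choose (t - j) := by
    rw [← Nat.choose_symm (by omega : t - j ≤ N - j)]
    congr 1
    omega
  have h5 : (j + t).choose j = (t + j).choose t := by
    rw [add_comm, ← Nat.choose_symm_add]
  rw [h4, h5]
  linear_combination -(-1) ^ j * ((t + j).choose t : ℝ) * h3

/-- The discrete Legendre operator on a binomial coefficient. -/
lemma legendre_operator_choose (N : ℝ) (x j : ℕ) :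
    (x + 2 : ℝ) * (N - x - 1) * ((x + 2).choose (j + 1) - (x + 1).choose (j + 1))
      - (x + 1) * (N - x) * ((x + 1).choose (j + 1) - x.choose (j + 1)) =
    (j + 1) * (N - j) * (x + 1).choose j
      - (j + 1) * (j + 2) * (x + 1).choose (j + 1) := by
  have h1 : ((x + 2).choose (j + 1) : ℝ) = (x + 1).choose j + (x + 1).choose (j + 1) := by
    exact_mod_cast Nat.choose_succ_succ (x + 1) j
  have h2 : ((x + 1).choose (j + 1) : ℝ) = x.choose j + x.choose (j + 1) := by
    exact_mod_cast Nat.choose_succ_succ x j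
  have h3 : (x + 1 : ℝ) * x.choose j = (x + 1).choose (j + 1) * (j + 1) := by
    exact_mod_cast Nat.add_one_mul_choose_eq x j
  have h4 : (x + 2 : ℝ) * (x + 1).choose j = (x + 2).choose (j + 1) * (j + 1) := by
    exact_mod_cast Nat.add_one_mul_choose_eq (x + 1) j
  have h5 : ((x + 1).choose j : ℝ) * (x + 1 - j) = (x + 1).choose (j + 1) * (j + 1) := by
    linear_combination h4 + (j + 1) * h1
  linear_combination (x + 2 : ℝ) * (N - x - 1) * h1 - (x + 1) * (N - x) * h2
    + (N - x - 1) * (h4 + (j + 1) * h1) - (N - x) * h3 - (j + 1) * h5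

lemma discreteLegendre_coeff_succ {N t j : ℕ} (hj : j < t) (h : t ≤ N) :
    ((j + 1 + t).choose (j + 1) * (N - (j + 1)).choose (N - t) : ℝ) * ((j + 1) * (N - j)) =
      (t * (t + 1) - j * (j + 1)) * ((j + t).choose j * (N - j).choose (N - t)) := by
  obtain ⟨m, rfl⟩ : ∃ m, N = j + 1 + m := ⟨N - (j + 1), by omega⟩
  have h1 : ((j + 1 + t).choose (j + 1) : ℝ) * (j + 1) = (j + t + 1) * (j + t).choose j := by
    rw [show j + 1 + t = j + t + 1 by ring]
    exact_mod_cast (Nat.add_one_mul_choose_eq (j + t) j).symm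
  have h2 : ((m + 1).choose (j + 1 + m - t) : ℝ) * (t - j) =
      (m + 1) * m.choose (j + 1 + m - t) := by
    have := Nat.choose_mul_succ_eq m (j + 1 + m - t)
    rw [show m + 1 - (j + 1 + m - t) = t - j by omega] at this
    rw [← Nat.cast_sub hj.le]
    exact_mod_cast (by rw [← this, mul_comm])
  rw [show j + 1 + m - (j + 1) = m by omega, show j + 1 + m - j = m + 1 by omega]
  push_cast
  linear_combination ((m : ℝ) + 1) * m.choose (j + 1 + m - t) * h1
    - (j + t + 1) * ((j + t).choose j : ℝ) * h2

lemma discreteLegendre_recurrence {N t : ℕ} (h : t ≤ N) (x : ℕ) :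
    (x + 2 : ℝ) * (N - x - 1) * (discreteLegendre N t (x + 2) - discreteLegendre N t (x + 1))
      - (x + 1) * (N - x) * (discreteLegendre N t (x + 1) - discreteLegendre N t x) =
    -(t * (t + 1)) * discreteLegendre N t (x + 1) := by
  let a (j : ℕ) : ℝ := (-1) ^ j * (j + t).choose j * (N - j).choose (N - t)
  have hrec : ∀ j ∈ range t,
      a (j + 1) * ((j + 1) * (N - j)) = (j * (j + 1) - t * (t + 1)) * a j := by
    intro j hj
    have := discreteLegendre_coeff_succ (mem_range.1 hj) h
    simp only [a, pow_succ]
    linear_combination -(-1) ^ j * this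
  have hdef (x : ℕ) : discreteLegendre N t x = ∑ j ∈ range (t + 1), a j * x.choose j := rfl
  have hsucc (x : ℕ) :
      discreteLegendre N t x = ∑ j ∈ range t, a (j + 1) * x.choose (j + 1) + a 0 := by
    simp [hdef, sum_range_succ']
  have hlow : ∑ j ∈ range t, (j * (j + 1) - t * (t + 1)) * a j * (x + 1).choose j =
      ∑ j ∈ range (t + 1), (j * (j + 1) - t * (t + 1)) * (a j * (x + 1).choose j) := by
    rw [sum_range_succ]
    simp [mul_assoc]
  have hhigh : ∑ j ∈ range t, (j + 1) * (j + 2) * (a (j + 1) * (x + 1).choose (j + 1)) =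
      ∑ j ∈ range (t + 1), (j * (j + 1) : ℝ) * (a j * (x + 1).choose j) := by
    rw [sum_range_succ']
    simp [add_assoc, one_add_one_eq_two]
  calc _ = ∑ j ∈ range t, ((j * (j + 1) - t * (t + 1)) * a j * (x + 1).choose j
        - (j + 1) * (j + 2) * (a (j + 1) * (x + 1).choose (j + 1))) := by
        rw [hsucc, hsucc, hsucc, add_sub_add_right_eq_sub, add_sub_add_right_eq_sub,
          ← sum_sub_distrib, ← sum_sub_distrib, mul_sum, mul_sum, ← sum_sub_distrib]
        refine sum_congr rfl fun j hj => ?_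
        linear_combination a (j + 1) * legendre_operator_choose N x j
          + ((x + 1).choose j : ℝ) * hrec j hj
    _ = _ := by
        rw [sum_sub_distrib, hlow, hhigh, ← sum_sub_distrib, hdef, mul_sum]
        exact sum_congr rfl fun j _ => by ring

lemma discreteLegendre_one_sub_zero {N t : ℕ} (ht : 0 < t) (h : t ≤ N) :
    N * (discreteLegendre N t 1 - discreteLegendre N t 0) =
      -(t * (t + 1)) * discreteLegendre N t 0 := by
  have hrec := discreteLegendre_coeff_succ ht h
  obtain ⟨s, rfl⟩ := Nat.exists_eq_succ_of_ne_zero ht.ne'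
  simp only [discreteLegendre, Nat.succ_eq_add_one] at hrec ⊢
  rw [sum_range_succ', sum_range_succ', sum_range_succ']
  simp [Nat.choose_eq_zero_of_lt] at hrec ⊢
  linear_combination -hrec

lemma discreteLegendre_sq_le {N t : ℕ} (ht : 0 < t) (h : t * (t + 1) ≤ N) {x : ℕ} (hx : x ≤ N) :
    discreteLegendre N t x ^ 2 ≤ 2 * (N.choose t : ℝ) ^ 2 := by
  have htN : t ≤ N := by nlinarith
  have hc : (0 : ℝ) < t * (t + 1) := by positivity
  have hcN : (t * (t + 1) : ℝ) ≤ N := by exact_mod_cast h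
  obtain hx2 | hx2 := le_total (2 * x) N
  · rw [← discreteLegendre_zero N t htN]
    exact sq_le_of_discrete_legendre hc hcN (discreteLegendre_one_sub_zero ht htN)
      (fun x _ => discreteLegendre_recurrence htN x) hx2
  · have key := sq_le_of_discrete_legendre (y := fun x => discreteLegendre N t (N - x)) hc hcN
      ?_ ?_ (x := N - x) (by omega)
    · simpa [Nat.sub_sub_self hx, discreteLegendre_self N t htN, mul_pow, ← pow_mul, mul_comm t 2]
        using key
    · obtain ⟨n, rfl⟩ := Nat.exists_eq_succ_of_ne_zero (by omega : N ≠ 0)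
      have := discreteLegendre_recurrence htN n
      simp only [Nat.succ_eq_add_one, Nat.add_sub_cancel, Nat.sub_zero] at this ⊢
      push_cast at this ⊢
      linear_combination this
    · intro x hx
      obtain ⟨n, rfl⟩ : ∃ n, N = x + n + 2 := ⟨N - (x + 2), by omega⟩
      have := discreteLegendre_recurrence htN n
      simp only [show x + n + 2 - (x + 2) = n by omega, show x + n + 2 - (x + 1) = n + 1 by omega,
        show x + n + 2 - x = n + 2 by omega]
      push_cast at this ⊢
      linear_combination this

lemma two_le_Lconst : 2 ≤ Lconst := by
  have h1 : 1 ≤ √2 := Real.one_le_sqrt.2 (by norm_num)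
  have h2 : √2 ≤ 2 := Real.sqrt_le_iff.2 (by norm_num)
  have h0 : 0 < √2 := by linarith
  have h3 : 1 / √2 ≤ 1 := (div_le_one h0).2 h1
  have hA : (2 : ℝ) ^ (1 + 1 / √2) ≤ (√2 + 1) ^ (1 + 1 / √2) :=
    Real.rpow_le_rpow (by norm_num) (by linarith) (by positivity)
  have hs : 0 < √2 - 1 := sub_pos.2 (Real.lt_sqrt_of_sq_lt (by norm_num))
  have hB : 1 ≤ (√2 - 1) ^ (-1 + 1 / √2) :=
    Real.one_le_rpow_of_pos_of_le_one_of_nonpos hs (by linarith) (by linarith)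
  calc (2 : ℝ) = 2 ^ (1 : ℝ) := (Real.rpow_one 2).symm
    _ ≤ 2 ^ (1 + 1 / √2 + -(1 / (2 * √2))) := by
      refine Real.rpow_le_rpow_of_exponent_le (by norm_num) ?_
      have : 1 / √2 + -(1 / (2 * √2)) = 1 / (2 * √2) := by
        field_simp
        norm_num
      have : 0 ≤ 1 / (2 * √2) := by positivity
      linarith
    _ = 2 ^ (1 + 1 / √2) * 1 * 2 ^ (-(1 / (2 * √2))) := by
      rw [Real.rpow_add (by norm_num), mul_one]
    _ ≤ Lconst := by
      unfold Lconst
      gcongr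

theorem stmt_6 (t k r : ℕ) (ht : 2 ≤ t) (htk : t ≤ k) (hkr : k ≤ r - 1)
    (hr : 2 * Lconst ^ t * (t : ℝ) ^ ((3 : ℝ) / 2) ≤ (r : ℝ)) :
    |(A t k r : ℝ)| < 3 * (Nat.choose (r - 1) t : ℝ) := by
  have hlarge : t * (t + 1) ≤ r - 1 := by
    have ht1 : (1 : ℝ) ≤ t := by exact_mod_cast (by omega : 1 ≤ t)
    have h1 : (t : ℝ) ≤ (t : ℝ) ^ ((3 : ℝ) / 2) :=
      Real.self_le_rpow_of_one_le ht1 (by norm_num)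
    have h2 : (t + 1 : ℝ) ≤ Lconst ^ t :=
      calc (t + 1 : ℝ) ≤ 2 ^ t := by exact_mod_cast Nat.lt_two_pow_self
        _ ≤ Lconst ^ t := pow_le_pow_left₀ (by norm_num) two_le_Lconst t
    have h3 : 2 * (t + 1 : ℝ) * t ≤ r :=
      (mul_le_mul (by linarith) h1 (by positivity) (by linarith)).trans hr
    have h4 : 2 * (t + 1) * t ≤ r := by exact_mod_cast h3
    have h5 : t * (t + 1) + 1 ≤ r := by nlinarith
    omega
  have hA : (A t k r : ℝ) = discreteLegendre (r - 1) t k := by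
    rw [A, discreteLegendre, min_eq_right htk]
    push_cast
    refine sum_congr rfl fun j _ => ?_
    rw [Nat.sub_right_comm r j 1, Nat.sub_right_comm r t 1]
    ring
  have hpos : (0 : ℝ) < (r - 1).choose t := by
    exact_mod_cast Nat.choose_pos (htk.trans hkr)
  rw [hA]
  refine abs_lt_of_sq_lt_sq ?_ (by positivity)
  nlinarith [discreteLegendre_sq_le (by omega) hlarge hkr]
end

section
/- Let n ≥ 1 be an integer and define, for real γ, c_n^γ := (1/n!) · (the n-th derivative of the real function x ↦ (1+x)^n·(1+γx)^{−(n+1)} evaluated at x = 0). Then for every γ ∈ (0,1) one has |c_n^γ| ≤ 2, and moreover |c_n^0| = 1 and |c_n^1| = 1. -/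
open Nat

/-- `c_n^γ := (1/n!) · (d/dx)^n [(1+x)^n (1+γx)^{-(n+1)}]` at `x = 0`. -/
noncomputable def cGamma (n : ℕ) (γ : ℝ) : ℝ :=
  (1 / (n ! : ℝ)) *
    iteratedDeriv n (fun x : ℝ => (1 + x) ^ n / (1 + γ * x) ^ (n + 1)) 0

open Polynomial in
/-- Legendre's differential equation, for the shifted Legendre polynomials. -/
lemma derivative_mul_derivative_shiftedLegendre (n : ℕ) :
    derivative ((X - X * X) * derivative (shiftedLegendre n)) =
      -((n * (n + 1) : ℕ) : ℤ[X]) * shiftedLegendre n := by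
  have key (k : ℕ) : ((k : ℤ) + 1) ^ 2 * (shiftedLegendre n).coeff (k + 1) =
      (k * (k + 1) - n * (n + 1)) * (shiftedLegendre n).coeff k := by
    simp only [coeff_shiftedLegendre]
    have h₁ : ((n.choose (k + 1) : ℕ) : ℤ) * (k + 1) = n.choose k * (n - k) := by
      rcases le_or_gt k n with h | h
      · have := Nat.choose_succ_right_eq n k
        zify [h] at this
        exact this
      · simp [Nat.choose_eq_zero_of_lt h, Nat.choose_eq_zero_of_lt (h.trans (Nat.lt_succ_self k))]
    have h₂ : (((n + (k + 1)).choose n : ℕ) : ℤ) * (k + 1) = (n + k).choose n * (n + k + 1) := by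
      have := Nat.choose_mul_succ_eq (n + k) n
      rw [show n + k + 1 - n = k + 1 by omega] at this
      zify at this
      rw [← add_assoc, ← this]
    linear_combination (-1) ^ (k + 1) * ((n + (k + 1)).choose n * (k + 1) : ℤ) * h₁ +
      (-1) ^ (k + 1) * (n.choose k * (n - k) : ℤ) * h₂
  have hX (p : ℤ[X]) (k : ℕ) : (X * derivative p).coeff k = k * p.coeff k := by
    cases k with
    | zero => simp
    | succ k => rw [coeff_X_mul, coeff_derivative]; push_cast; ring
  ext k
  rw [neg_mul, coeff_neg, coeff_natCast_mul, coeff_derivative, sub_mul, coeff_sub, mul_assoc,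
    coeff_X_mul, coeff_X_mul, hX, coeff_derivative]
  push_cast
  linear_combination key k

open Polynomial in
lemma aeval_zero_shiftedLegendre (n : ℕ) : aeval (0 : ℝ) (shiftedLegendre n) = 1 := by
  rw [← coeff_zero_eq_aeval_zero', coeff_shiftedLegendre]
  simp

open Polynomial in
lemma aeval_one_shiftedLegendre (n : ℕ) : aeval (1 : ℝ) (shiftedLegendre n) = (-1) ^ n := by
  rw [shiftedLegendre_eval_symm, sub_self, aeval_zero_shiftedLegendre, mul_one]

open Polynomial in
/-- The shifted Legendre polynomials are bounded by `1` on `[0, 1]`. -/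
theorem abs_aeval_shiftedLegendre_le_one {n : ℕ} {x : ℝ} (hx : x ∈ Set.Icc (0 : ℝ) 1) :
    |aeval x (shiftedLegendre n)| ≤ 1 := by
  rcases n.eq_zero_or_pos with rfl | hn
  · simp [shiftedLegendre]
  set P := shiftedLegendre n with hP
  have hN : (0 : ℝ) < n * (n + 1) := by positivity
  have ode (y : ℝ) : (y - y * y) * aeval y (derivative (derivative P)) =
      -(1 - 2 * y) * aeval y (derivative P) - n * (n + 1) * aeval y P := by
    have := congrArg (aeval y) (derivative_mul_derivative_shiftedLegendre n)
    simp only [derivative_mul, map_sub, map_add, map_mul, map_neg, derivative_X, aeval_X,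
      map_one, map_natCast, ← hP] at this
    push_cast at this
    linear_combination this
  let F (y : ℝ) : ℝ :=
    (y - y * y) * (aeval y (derivative P)) ^ 2 / (n * (n + 1)) + (aeval y P) ^ 2
  have hF (y : ℝ) : HasDerivAt F
      (-(1 - 2 * y) * (aeval y (derivative P)) ^ 2 / (n * (n + 1))) y := by
    have h₀ := P.hasDerivAt_aeval y
    have h₁ := (derivative P).hasDerivAt_aeval y
    have h₂ := (hasDerivAt_id y).sub ((hasDerivAt_id y).mul (hasDerivAt_id y))
    refine (((h₂.mul (h₁.pow 2)).div_const _).add (h₀.pow 2)).congr_deriv ?_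
    simp only [id, Pi.mul_apply, Pi.sub_apply, Pi.pow_apply]
    field_simp
    push_cast
    linear_combination 2 * aeval y (derivative P) * ode y
  have hF_cont : Continuous F := continuous_iff_continuousAt.2 fun y => (hF y).continuousAt
  have hF_le : F x ≤ 1 := by
    rcases le_total x (1 / 2) with h | h
    · have hanti : AntitoneOn F (Set.Icc 0 (1 / 2)) := by
        refine antitoneOn_of_deriv_nonpos (convex_Icc _ _) hF_cont.continuousOn
          (fun y _ => (hF y).differentiableAt.differentiableWithinAt) fun y hy => ?_
        rw [interior_Icc] at hy
        rw [(hF y).deriv]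
        refine div_nonpos_of_nonpos_of_nonneg ?_ hN.le
        exact mul_nonpos_of_nonpos_of_nonneg (by linarith [hy.2]) (sq_nonneg _)
      have := hanti (by norm_num) ⟨hx.1, h⟩ hx.1
      simpa [F, P, aeval_zero_shiftedLegendre] using this
    · have hmono : MonotoneOn F (Set.Icc (1 / 2) 1) := by
        refine monotoneOn_of_deriv_nonneg (convex_Icc _ _) hF_cont.continuousOn
          (fun y _ => (hF y).differentiableAt.differentiableWithinAt) fun y hy => ?_
        rw [interior_Icc] at hy
        rw [(hF y).deriv]
        exact div_nonneg (mul_nonneg (by linarith [hy.1]) (sq_nonneg _)) hN.le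
      have := hmono ⟨h, hx.2⟩ (by norm_num) hx.2
      simpa [F, P, aeval_one_shiftedLegendre, ← pow_mul, mul_comm n 2] using this
  rw [← sq_le_one_iff_abs_le_one]
  have : 0 ≤ (x - x * x) * (aeval x (derivative P)) ^ 2 / (n * (n + 1)) := by
    have : 0 ≤ x - x * x := by nlinarith [hx.1, hx.2]
    positivity
  simp only [F] at hF_le
  linarith

lemma iteratedDeriv_inv_one_add_mul_pow (γ : ℝ) (m k : ℕ) {x : ℝ} (hx : 1 + γ * x ≠ 0) :
    iteratedDeriv k (fun y : ℝ => ((1 + γ * y) ^ (m + 1))⁻¹) x =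
      (-γ) ^ k * (m + 1).ascFactorial k * ((1 + γ * x) ^ (m + 1 + k))⁻¹ := by
  induction k generalizing x with
  | zero => simp
  | succ k ih =>
    have hev : iteratedDeriv k (fun y : ℝ => ((1 + γ * y) ^ (m + 1))⁻¹) =ᶠ[nhds x]
        fun y => (-γ) ^ k * (m + 1).ascFactorial k * ((1 + γ * y) ^ (m + 1 + k))⁻¹ := by
      have : ∀ᶠ y in nhds x, 1 + γ * y ≠ 0 :=
        (by fun_prop : Continuous fun y : ℝ => 1 + γ * y).continuousAt.eventually_ne hx
      filter_upwards [this] with y hy using ih hy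
    have h₁ : HasDerivAt (fun y : ℝ => 1 + γ * y) γ x := by
      simpa using ((hasDerivAt_id x).const_mul γ).const_add 1
    have h₂ := ((h₁.fun_pow (m + 1 + k)).fun_inv (pow_ne_zero _ hx)).const_mul
      ((-γ) ^ k * ((m + 1).ascFactorial k : ℝ))
    rw [iteratedDeriv_succ, hev.deriv_eq, h₂.deriv, Nat.ascFactorial_succ,
      show m + 1 + k - 1 = m + k by omega]
    push_cast
    field_simp
    ring

lemma cGamma_eq_aeval_shiftedLegendre (n : ℕ) (γ : ℝ) :
    cGamma n γ = Polynomial.aeval γ (Polynomial.shiftedLegendre n) := by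
  have hsmooth : ContDiffAt ℝ n (fun x : ℝ => ((1 + γ * x) ^ (n + 1))⁻¹) 0 :=
    ContDiffAt.inv (by fun_prop) (by simp)
  have hpow (i : ℕ) : iteratedDeriv i (fun x : ℝ => (1 + x) ^ n) 0 = n.descFactorial i := by
    rw [iteratedDeriv_comp_const_add i (fun x : ℝ => x ^ n) 1]
    simp
  simp only [cGamma, div_eq_mul_inv _ ((_ : ℝ) ^ (n + 1))]
  rw [iteratedDeriv_fun_mul (by fun_prop) hsmooth, ← Finset.sum_range_reflect, Finset.mul_sum,
    Polynomial.shiftedLegendre, map_sum]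
  refine Finset.sum_congr rfl fun k hk => ?_
  have hkn : k ≤ n := Nat.lt_succ_iff.1 (Finset.mem_range.1 hk)
  rw [show n + 1 - 1 - k = n - k by omega, show n - (n - k) = k by omega, hpow,
    iteratedDeriv_inv_one_add_mul_pow γ n k (by simp), Nat.choose_symm hkn]
  have h : ((n.descFactorial (n - k) * (n + 1).ascFactorial k : ℕ) : ℝ) =
      (n ! * (n + k).choose n : ℕ) := by
    congr 1
    have h₁ := Nat.factorial_mul_descFactorial (Nat.sub_le n k)
    rw [show n - (n - k) = k by omega] at h₁
    have h₂ := Nat.factorial_mul_ascFactorial n k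
    have h₃ := Nat.add_choose_mul_factorial_mul_factorial n k
    rw [← Nat.choose_symm_add] at h₃
    refine Nat.eq_of_mul_eq_mul_left (Nat.mul_pos k.factorial_pos n.factorial_pos) ?_
    calc k ! * n ! * (n.descFactorial (n - k) * (n + 1).ascFactorial k)
        = (k ! * n.descFactorial (n - k)) * (n ! * (n + 1).ascFactorial k) := by ring
      _ = n ! * ((n + k).choose n * n ! * k !) := by rw [h₁, h₂, h₃]
      _ = k ! * n ! * (n ! * (n + k).choose n) := by ring
  push_cast at h
  have hn : (n ! : ℝ) ≠ 0 := by positivity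
  simp only [map_mul, map_pow, Polynomial.aeval_X, mul_zero, add_zero, one_pow,
    inv_one, mul_one, neg_pow γ k, map_neg, map_one, map_natCast]
  field_simp
  linear_combination n.choose k * γ ^ k * h

theorem stmt_7 (n : ℕ) (hn : 1 ≤ n) :
    (∀ γ ∈ Set.Ioo (0 : ℝ) 1, |cGamma n γ| ≤ 2) ∧
      |cGamma n 0| = 1 ∧ |cGamma n 1| = 1 := by
  simp only [cGamma_eq_aeval_shiftedLegendre]
  refine ⟨fun γ hγ => ?_, ?_, ?_⟩
  · exact (abs_aeval_shiftedLegendre_le_one (Set.Ioo_subset_Icc_self hγ)).trans one_le_two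
  · rw [aeval_zero_shiftedLegendre, abs_one]
  · rw [aeval_one_shiftedLegendre, abs_neg_one_pow]
end
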